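/- Let G be the simple graph on six vertices v1,...,v6 whose edges are the cycle edges v1v2, v2v3, v3v4, v4v5, v5v6, v6v1 together with the chords v1v3, v1v5 and v2v6 (this is the graph G^6_110 in Harary's enumeration of six-vertex graphs). Then for every integer n ≥ 1, the crossing number of the Cartesian product G □ P_n equals 3n − 1. -/

import Mathlib

open SimpleGraph

/-- A drawing of a simple graph in the plane: vertices are mapped to distinct
points, and each edge is mapped to a simple arc (parametrised by `[0,1]`)
joining the images of its endpoints and avoiding the images of all vertices
in its interior. -/
structure Drawing {V : Type*} (G : SimpleGraph V) where
  vertexMap : V → ℝ × ℝ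
  vertexMap_injective : Function.Injective vertexMap
  arc : G.edgeSet → ℝ → ℝ × ℝ
  arc_continuousOn : ∀ e, ContinuousOn (arc e) (Set.Icc 0 1)
  arc_injOn : ∀ e, Set.InjOn (arc e) (Set.Icc 0 1)
  arc_endpoints : ∀ e : G.edgeSet, ∃ u v : V,
    (e : Sym2 V) = s(u, v) ∧ arc e 0 = vertexMap u ∧ arc e 1 = vertexMap v
  arc_avoids_vertices : ∀ e : G.edgeSet, ∀ t ∈ Set.Ioo (0 : ℝ) 1, ∀ w : V,
    arc e t ≠ vertexMap w

/-- The crossings of a drawing: an unordered pair of distinct edges together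
with a point of the plane where the two corresponding arcs intersect away
from their endpoints. -/
def Drawing.crossings {V : Type*} {G : SimpleGraph V} (D : Drawing G) :
    Set (Sym2 G.edgeSet × (ℝ × ℝ)) :=
  { x | ∃ e f : G.edgeSet, e ≠ f ∧ x.1 = s(e, f) ∧
      (∃ s ∈ Set.Ioo (0 : ℝ) 1, D.arc e s = x.2) ∧
      (∃ t ∈ Set.Ioo (0 : ℝ) 1, D.arc f t = x.2) }

/-- The crossing number of a simple graph: the minimum number of crossings
over all drawings of the graph in the plane. -/
noncomputable def crossingNumber {V : Type*} (G : SimpleGraph V) : ℕ :=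
  sInf { n : ℕ | ∃ D : Drawing G, D.crossings.Finite ∧ D.crossings.ncard = n }

/-- The graph `G⁶₁₁₀`: the 6-cycle `v1 v2 v3 v4 v5 v6` together with the
chords `v1v3`, `v1v5` and `v2v6`. -/
def G6_110 : SimpleGraph (Fin 6) :=
  SimpleGraph.fromEdgeSet
    {s(0, 1), s(1, 2), s(2, 3), s(3, 4), s(4, 5), s(5, 0), s(0, 2), s(0, 4), s(1, 5)}

/-! ### Winding of curves and `K₃,₃` -/

/-- A continuous nonvanishing function on a simply connected space has a continuous logarithm. -/
theorem exists_continuous_log {X : Type*} [TopologicalSpace X] [SimplyConnectedSpace X]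
    [LocallyPathConnectedSpace X] {g : X → ℂ} (hg : Continuous g) (h0 : ∀ x, g x ≠ 0) :
    ∃ l : X → ℂ, Continuous l ∧ ∀ x, Complex.exp (l x) = g x := by
  obtain ⟨x₀⟩ : Nonempty X := inferInstance
  obtain ⟨f, ⟨-, hf⟩, -⟩ := Complex.isCoveringMapOn_exp.existsUnique_continuousMap_lifts
    ⟨g, hg⟩ (a₀ := x₀) (Complex.exp_log (h0 x₀)) h0
  exact ⟨f, f.continuous, fun x ↦ congrFun hf x⟩

/-- The increment from `0` to `1` of a continuous logarithm of `g` (and `0` if there is none). -/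
noncomputable def logIncrement (g : ℝ → ℂ) : ℂ :=
  open Classical in
  if h : ∃ l : ℝ → ℂ, Continuous l ∧ ∀ t, Complex.exp (l t) = g t then
    h.choose 1 - h.choose 0 else 0

theorem logIncrement_eq {g l : ℝ → ℂ} (hl : Continuous l) (h : ∀ t, Complex.exp (l t) = g t) :
    logIncrement g = l 1 - l 0 := by
  have hex : ∃ l : ℝ → ℂ, Continuous l ∧ ∀ t, Complex.exp (l t) = g t := ⟨l, hl, h⟩
  rw [logIncrement, dif_pos hex]
  obtain ⟨hm, hm'⟩ := hex.choose_spec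
  set m := hex.choose
  have hg : Continuous g := by
    rw [show g = fun t ↦ Complex.exp (l t) from funext fun t ↦ (h t).symm]
    fun_prop
  obtain ⟨F, -, hF⟩ := Complex.isCoveringMapOn_exp.existsUnique_continuousMap_lifts
    ⟨g, hg⟩ (a₀ := 0) (h 0) (fun t ↦ by simp [← h t])
  have h1 := hF ⟨l, hl⟩ ⟨rfl, funext h⟩
  have h2 := hF ⟨fun t ↦ m t + (l 0 - m 0), by fun_prop⟩ ⟨by simp, funext fun t ↦ by
    have hne : g 0 ≠ 0 := by simp [← h 0]
    simp [Complex.exp_add, Complex.exp_sub, h, hm', hne]⟩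
  have := congrArg (fun f : C(ℝ, ℂ) ↦ f 1) (h1.trans h2.symm)
  simp only [ContinuousMap.coe_mk] at this
  rw [this]
  ring

theorem exp_logIncrement {g : ℝ → ℂ} (hg : Continuous g) (h0 : ∀ t, g t ≠ 0) :
    Complex.exp (logIncrement g) = g 1 / g 0 := by
  obtain ⟨l, hl, h⟩ := exists_continuous_log hg h0
  rw [logIncrement_eq hl h, Complex.exp_sub, h, h]

/-- Going around the boundary of the unit square, the logarithm of the difference of two
disjoint curves does not change. -/
theorem logIncrement_sub_comm {γ δ : ℝ → ℂ} (hγ : Continuous γ) (hδ : Continuous δ)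
    (h : ∀ s t, γ s ≠ δ t) :
    logIncrement (fun s ↦ γ s - δ 0) + logIncrement (fun t ↦ δ t - γ 1) =
      logIncrement (fun s ↦ γ s - δ 1) + logIncrement (fun t ↦ δ t - γ 0) := by
  obtain ⟨L, hL, hexp⟩ := exists_continuous_log (X := ℝ × ℝ) (g := fun x ↦ γ x.1 - δ x.2)
    (by fun_prop) (fun x ↦ sub_ne_zero.2 (h _ _))
  have e1 (t : ℝ) : logIncrement (fun s ↦ γ s - δ t) = L (1, t) - L (0, t) :=
    logIncrement_eq (l := fun s ↦ L (s, t)) (by fun_prop) (fun s ↦ hexp (s, t))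
  have e2 (s : ℝ) : logIncrement (fun t ↦ δ t - γ s) = L (s, 1) - L (s, 0) := by
    rw [logIncrement_eq (l := fun t ↦ L (s, t) + Real.pi * Complex.I) (by fun_prop)]
    · ring
    · intro t
      rw [Complex.exp_add, hexp, Complex.exp_pi_mul_I]
      ring
  rw [e1, e1, e2, e2]
  ring

/-- The complete bipartite graph `K₃,₃` cannot be mapped to the plane with disjoint images of
nonadjacent edges. -/
theorem not_forall_disjoint_curves (p q : Fin 3 → ℂ) (γ : Fin 3 → Fin 3 → ℝ → ℂ)
    (hc : ∀ i j, Continuous (γ i j)) (h0 : ∀ i j, γ i j 0 = p i) (h1 : ∀ i j, γ i j 1 = q j)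
    (h : ∀ i j k l, i ≠ k → j ≠ l → ∀ s t, γ i j s ≠ γ k l t) : False := by
  have other (i : Fin 3) : ∃ k, i ≠ k := by revert i; decide
  have hp (i j k) (hik : i ≠ k) (s) : γ i j s - p k ≠ 0 := by
    obtain ⟨l, hl⟩ := other j
    rw [sub_ne_zero, ← h0 k l]
    exact h _ _ _ _ hik hl _ _
  have hq (i j l) (hjl : j ≠ l) (s) : γ i j s - q l ≠ 0 := by
    obtain ⟨k, hk⟩ := other i
    rw [sub_ne_zero, ← h1 k l]
    exact h _ _ _ _ hk hjl _ _
  have hu (j i) : q j - p i ≠ 0 := by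
    obtain ⟨k, hk⟩ := other i
    simpa [h1] using hp k j i hk.symm 1
  set a : Fin 3 → Fin 3 → Fin 3 → ℂ := fun i j k ↦ logIncrement (fun s ↦ γ i j s - p k) with ha
  set b : Fin 3 → Fin 3 → Fin 3 → ℂ := fun i j l ↦ logIncrement (fun s ↦ γ i j s - q l) with hb
  have rel (i j k l) (hik : i ≠ k) (hjl : j ≠ l) : a i j k + b k l j = b i j l + a k l i := by
    have := logIncrement_sub_comm (hc i j) (hc k l) (h i j k l hik hjl)
    simpa only [h0, h1] using this
  have hcont (i j) (z : ℂ) : Continuous fun s ↦ γ i j s - z := (hc i j).sub continuous_const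
  have ea (i j k) (hik : i ≠ k) : Complex.exp (a i j k) = (q j - p k) / (p i - p k) := by
    simp only [ha]
    rw [exp_logIncrement (hcont i j _) (hp i j k hik), h0, h1]
  have eb (i j l) (hjl : j ≠ l) : Complex.exp (b i j l) = (q j - q l) / (p i - q l) := by
    simp only [hb]
    rw [exp_logIncrement (hcont i j _) (hq i j l hjl), h0, h1]
  have eA (i j k) (hik : i ≠ k) :
      Complex.exp (a i j k - a k j i) = - ((q j - p k) / (q j - p i)) := by
    have hpp : p i - p k ≠ 0 := by simpa [h0] using hp i 0 k hik 0
    have hpp' : p k - p i ≠ 0 := by simpa [h0] using hp k 0 i hik.symm 0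
    rw [Complex.exp_sub, ea _ _ _ hik, ea _ _ _ hik.symm]
    have := hu j i
    field_simp
    ring
  have eB (j l) (hjl : j ≠ l) :
      Complex.exp (b 2 j l - b 0 j l) = (q l - p 0) / (q l - p 2) := by
    have hqq : q j - q l ≠ 0 := by simpa [h1] using hq 0 j l hjl 1
    have h2 : p 2 - q l ≠ 0 := by rw [← neg_sub]; exact neg_ne_zero.2 (hu l 2)
    have h3 : p 0 - q l ≠ 0 := by rw [← neg_sub]; exact neg_ne_zero.2 (hu l 0)
    have := hu l 2
    rw [Complex.exp_sub, eb _ _ _ hjl, eb _ _ _ hjl]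
    field_simp
    ring
  have key (j l m) (hl : l ≠ j) (hm : m ≠ j) :
      Complex.exp ((a 0 j 1 - a 1 j 0) + (a 0 j 2 - a 2 j 0) + (a 1 j 2 - a 2 j 1) +
        (b 2 l j - b 0 l j) + (b 2 m j - b 0 m j)) = -1 := by
    rw [Complex.exp_add, Complex.exp_add, Complex.exp_add, Complex.exp_add, eA _ _ _ (by decide),
      eA _ _ _ (by decide), eA _ _ _ (by decide), eB _ _ hl, eB _ _ hm]
    have := hu j 0
    have := hu j 1
    have := hu j 2
    field_simp
  have k0 := key 0 1 2 (by decide) (by decide)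
  have k1 := key 1 0 2 (by decide) (by decide)
  have k2 := key 2 0 1 (by decide) (by decide)
  have : (1 : ℂ) = -1 * -1 * -1 := by
    nth_rw 1 [← k0]
    nth_rw 1 [← k1]
    rw [← k2, ← Complex.exp_add, ← Complex.exp_add, ← Complex.exp_zero]
    congr 1
    have r01 := fun j l hjl ↦ rel 0 j 1 l (by decide) hjl
    have r02 := fun j l hjl ↦ rel 0 j 2 l (by decide) hjl
    have r12 := fun j l hjl ↦ rel 1 j 2 l (by decide) hjl
    linear_combination (-1 / 2) * (
      r01 0 1 (by decide) + r01 0 2 (by decide) + r01 1 0 (by decide) + r01 1 2 (by decide) +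
      r01 2 0 (by decide) + r01 2 1 (by decide) +
      r02 0 1 (by decide) + r02 0 2 (by decide) + r02 1 0 (by decide) + r02 1 2 (by decide) +
      r02 2 0 (by decide) + r02 2 1 (by decide) +
      r12 0 1 (by decide) + r12 0 2 (by decide) + r12 1 0 (by decide) + r12 1 2 (by decide) +
      r12 2 0 (by decide) + r12 2 1 (by decide))
  norm_num at this

/-- If six points of the plane are joined in a `K₃,₃` pattern by subsets, then two nonadjacent
subsets meet. -/
theorem exists_nonadjacent_inter_nonempty (p q : Fin 3 → ℝ × ℝ) (A : Fin 3 → Fin 3 → Set (ℝ × ℝ))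
    (hA : ∀ i j, JoinedIn (A i j) (p i) (q j)) :
    ∃ i j k l, i ≠ k ∧ j ≠ l ∧ (A i j ∩ A k l).Nonempty := by
  by_contra! hcon
  let φ : (ℝ × ℝ) ≃L[ℝ] ℂ := Complex.equivRealProdCLM.symm
  refine not_forall_disjoint_curves (fun i ↦ φ (p i)) (fun j ↦ φ (q j))
    (fun i j t ↦ φ ((hA i j).somePath.extend t)) (fun i j ↦ by fun_prop) (by simp) (by simp) ?_
  intro i j k l hik hjl s t hst
  have hmem (i j t) : (hA i j).somePath.extend t ∈ A i j := by
    have := (hA i j).somePath.extend_range ▸ Set.mem_range_self t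
    obtain ⟨u, hu⟩ := this
    exact hu ▸ (hA i j).somePath_mem u
  have := hcon i j k l hik hjl
  exact (Set.eq_empty_iff_forall_notMem.1 this) _ ⟨hmem i j s, φ.injective hst ▸ hmem k l t⟩

/-! ### Straight-line drawings -/

/-- The drawing of `G` with straight edges and vertices at prescribed positions. -/
noncomputable def straightDrawing {V : Type*} (G : SimpleGraph V) (P : V → ℝ × ℝ)
    (hP : Function.Injective P)
    (hav : ∀ u v, G.Adj u v → ∀ w, P w ∉ openSegment ℝ (P u) (P v)) : Drawing G where
  vertexMap := P
  vertexMap_injective := hP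
  arc e := AffineMap.lineMap (P (Quot.out e.1).1) (P (Quot.out e.1).2)
  arc_continuousOn e := AffineMap.lineMap_continuous.continuousOn
  arc_injOn e := by
    have hadj : G.Adj (Quot.out e.1).1 (Quot.out e.1).2 := by
      have h : s((Quot.out e.1).1, (Quot.out e.1).2) = e.1 := Quot.out_eq e.1
      rw [← mem_edgeSet, h]
      exact e.2
    exact (AffineMap.lineMap_injective ℝ (hP.ne hadj.ne)).injOn
  arc_endpoints e := ⟨_, _, (Quot.out_eq e.1).symm, AffineMap.lineMap_apply_zero _ _,
    AffineMap.lineMap_apply_one _ _⟩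
  arc_avoids_vertices e t ht w hw := by
    have hadj : G.Adj (Quot.out e.1).1 (Quot.out e.1).2 := by
      have h : s((Quot.out e.1).1, (Quot.out e.1).2) = e.1 := Quot.out_eq e.1
      rw [← mem_edgeSet, h]
      exact e.2
    refine hav _ _ hadj w ?_
    rw [openSegment_eq_image_lineMap]
    exact ⟨t, ht, hw⟩

theorem mem_openSegment_of_straightDrawing {V : Type*} {G : SimpleGraph V} {P : V → ℝ × ℝ}
    {hP : Function.Injective P}
    {hav : ∀ u v, G.Adj u v → ∀ w, P w ∉ openSegment ℝ (P u) (P v)} {e : G.edgeSet} {u v : V}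
    (he : (e : Sym2 V) = s(u, v)) {t : ℝ} (ht : t ∈ Set.Ioo (0 : ℝ) 1) :
    (straightDrawing G P hP hav).arc e t ∈ openSegment ℝ (P u) (P v) := by
  have hmem : (straightDrawing G P hP hav).arc e t ∈
      openSegment ℝ (P (Quot.out e.1).1) (P (Quot.out e.1).2) := by
    rw [openSegment_eq_image_lineMap]
    exact ⟨t, ht, rfl⟩
  have : s((Quot.out e.1).1, (Quot.out e.1).2) = s(u, v) := (Quot.out_eq e.1).trans he
  rcases Sym2.eq_iff.1 this with ⟨h1, h2⟩ | ⟨h1, h2⟩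
  · rwa [h1, h2] at hmem
  · rwa [h1, h2, openSegment_symm] at hmem

/-! ### Intersections of segments -/

theorem disjoint_openSegment_of_le {E : Type*} [AddCommGroup E] [Module ℝ E] (f : E →ₗ[ℝ] ℝ)
    {p q r s : E} (hpr : f p ≤ f r) (hps : f p ≤ f s) (hqr : f q ≤ f r) (hqs : f q ≤ f s)
    (h : f p < f r ∨ f p < f s ∨ f q < f r ∨ f q < f s) :
    Disjoint (openSegment ℝ p q) (openSegment ℝ r s) := by
  rw [Set.disjoint_left]
  rintro x ⟨a, b, ha, hb, hab, rfl⟩ ⟨c, d, hc, hd, hcd, hx⟩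
  have hf := congrArg f hx
  simp only [map_add, map_smul, smul_eq_mul] at hf
  have key : a * c * (f r - f p) + a * d * (f s - f p) + b * c * (f r - f q) +
      b * d * (f s - f q) = 0 := by
    obtain rfl : b = 1 - a := by linarith
    obtain rfl : d = 1 - c := by linarith
    linear_combination hf
  have h1 := mul_nonneg (mul_pos ha hc).le (sub_nonneg.2 hpr)
  have h2 := mul_nonneg (mul_pos ha hd).le (sub_nonneg.2 hps)
  have h3 := mul_nonneg (mul_pos hb hc).le (sub_nonneg.2 hqr)
  have h4 := mul_nonneg (mul_pos hb hd).le (sub_nonneg.2 hqs)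
  rcases h with h | h | h | h
  · have := mul_pos (mul_pos ha hc) (sub_pos.2 h)
    linarith
  · have := mul_pos (mul_pos ha hd) (sub_pos.2 h)
    linarith
  · have := mul_pos (mul_pos hb hc) (sub_pos.2 h)
    linarith
  · have := mul_pos (mul_pos hb hd) (sub_pos.2 h)
    linarith

theorem subsingleton_openSegment_inter {p q r s : ℝ × ℝ}
    (h : (q.1 - p.1) * (s.2 - r.2) - (q.2 - p.2) * (s.1 - r.1) ≠ 0) :
    (openSegment ℝ p q ∩ openSegment ℝ r s).Subsingleton := by
  simp only [openSegment_eq_image_lineMap]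
  rintro x ⟨⟨a, -, rfl⟩, c, -, hc⟩ y ⟨⟨b, -, rfl⟩, d, -, hd⟩
  have hc1 := congrArg Prod.fst hc
  have hc2 := congrArg Prod.snd hc
  have hd1 := congrArg Prod.fst hd
  have hd2 := congrArg Prod.snd hd
  simp only [AffineMap.lineMap_apply_module, Prod.fst_add, Prod.snd_add, Prod.smul_fst,
    Prod.smul_snd, smul_eq_mul] at hc1 hc2 hd1 hd2
  have : (a - b) * ((q.1 - p.1) * (s.2 - r.2) - (q.2 - p.2) * (s.1 - r.1)) = 0 := by
    linear_combination (s.1 - r.1) * (hc2 - hd2) - (s.2 - r.2) * (hc1 - hd1)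
  rw [sub_eq_zero.1 ((mul_eq_zero.1 this).resolve_right h)]

/-! ### The positions of the vertices -/

/-- Positions of the vertices of one copy of `G⁶₁₁₀`, before scaling. -/
def basePos : Fin 6 → ℤ × ℤ :=
  ![(0, 1), (2, 2), (6, -2), (0, -6), (-6, -2), (-2, 2)]

/-- The position of the vertex `v` in the `i`-th copy of `G⁶₁₁₀`: the copies are nested, each one
being a scaled copy of the next one, except that vertex `0` of the outermost copy is outside. -/
noncomputable def nestedPos (x : Fin 6 × ℕ) : ℝ × ℝ :=
  if x.1 = 0 ∧ x.2 = 0 then (0, 10)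
  else ((20 ^ x.2 : ℝ)⁻¹ * (basePos x.1).1, (20 ^ x.2 : ℝ)⁻¹ * (basePos x.1).2)

/-- Integral coordinates of the vertices of copies `i`, `i + 1`, `i + 2` in the unit
`20 ^ (-(i + 2))`. The argument `outer` tells whether `i = 0`. -/
def scaledPos (outer : Bool) (x : Fin 6 × ℕ) : ℤ × ℤ :=
  if outer && x.1 == 0 && x.2 == 0 then (0, 4000)
  else (20 ^ (2 - x.2) * (basePos x.1).1, 20 ^ (2 - x.2) * (basePos x.1).2)

/-- The vertex `x`, moved by `m` copies. -/
def shiftCopy (m : ℕ) (x : Fin 6 × ℕ) : Fin 6 × ℕ := (x.1, x.2 + m)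

theorem nestedPos_shiftCopy (m : ℕ) {x : Fin 6 × ℕ} (hx : x.2 ≤ 2) :
    nestedPos (shiftCopy m x) = ((20 ^ (m + 2) : ℝ)⁻¹ * (scaledPos (m == 0) x).1,
      (20 ^ (m + 2) : ℝ)⁻¹ * (scaledPos (m == 0) x).2) := by
  obtain ⟨v, d⟩ := x
  have hpow : (20 ^ (d + m) : ℝ)⁻¹ = (20 ^ (m + 2) : ℝ)⁻¹ * 20 ^ (2 - d) := by
    have : m + 2 = (d + m) + (2 - d) := by simp only at hx; omega
    rw [this, pow_add _ (d + m)]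
    field_simp
  by_cases h : v = 0 ∧ d + m = 0
  · obtain ⟨rfl, h⟩ := h
    obtain ⟨rfl, rfl⟩ : d = 0 ∧ m = 0 := by omega
    norm_num [nestedPos, scaledPos, shiftCopy]
  · have h' : ¬ ((m == 0 && v == 0 && d == 0) = true) := by
      simp only [Bool.and_eq_true, beq_iff_eq]
      rintro ⟨⟨rfl, rfl⟩, rfl⟩
      exact h ⟨rfl, rfl⟩
    simp only [nestedPos, scaledPos, shiftCopy, if_neg h, if_neg h', hpow]
    push_cast
    simp only [mul_assoc]

/-- The linear form with coefficients `l`. -/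
def intForm (l p : ℤ × ℤ) : ℤ := l.1 * p.1 + l.2 * p.2

/-- The linear form with coefficients `l` on the real plane. -/
noncomputable def realForm (l : ℤ × ℤ) : ℝ × ℝ →ₗ[ℝ] ℝ :=
  (l.1 : ℝ) • LinearMap.fst ℝ ℝ ℝ + (l.2 : ℝ) • LinearMap.snd ℝ ℝ ℝ

theorem realForm_apply (l : ℤ × ℤ) (x : ℝ × ℝ) : realForm l x = l.1 * x.1 + l.2 * x.2 := by
  simp [realForm]

/-- The points `p`, `q` are weakly separated from `r`, `s` by the form `l`. -/
def separatedBy (p q r s l : ℤ × ℤ) : Bool :=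
  let a := intForm l p
  let b := intForm l q
  let c := intForm l r
  let d := intForm l s
  decide (a ≤ c) && decide (a ≤ d) && decide (b ≤ c) && decide (b ≤ d) &&
    (decide (a < c) || decide (a < d) || decide (b < c) || decide (b < d))

/-- The points `p`, `q` are weakly separated from `r`, `s` by one of a few natural forms. -/
def separated (p q r s : ℤ × ℤ) : Bool :=
  [(p.2 - q.2, q.1 - p.1), (q.2 - p.2, p.1 - q.1), (r.2 - s.2, s.1 - r.1),
    (s.2 - r.2, r.1 - s.1), (0, 1), (0, -1), (1, 0), (-1, 0), (r.1 - p.1, r.2 - p.2)].any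
    (separatedBy p q r s)

theorem disjoint_of_separated {p q r s : ℤ × ℤ} (h : separated p q r s) {c : ℝ} (hc : 0 < c) :
    Disjoint (openSegment ℝ (c * p.1, c * p.2) ((c * q.1, c * q.2) : ℝ × ℝ))
      (openSegment ℝ (c * r.1, c * r.2) (c * s.1, c * s.2)) := by
  obtain ⟨l, -, hl⟩ := List.any_eq_true.1 h
  have e (x : ℤ × ℤ) : realForm l (c * x.1, c * x.2) = c * (intForm l x : ℤ) := by
    rw [realForm_apply, intForm]
    push_cast
    ring
  simp only [separatedBy, Bool.and_eq_true, Bool.or_eq_true, decide_eq_true_eq] at hl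
  obtain ⟨⟨⟨⟨h1, h2⟩, h3⟩, h4⟩, h5⟩ := hl
  have le {a b : ℤ} (hab : a ≤ b) : c * (a : ℝ) ≤ c * b :=
    mul_le_mul_of_nonneg_left (by exact_mod_cast hab) hc.le
  have lt {a b : ℤ} (hab : a < b) : c * (a : ℝ) < c * b :=
    mul_lt_mul_of_pos_left (by exact_mod_cast hab) hc
  refine disjoint_openSegment_of_le (realForm l) ?_ ?_ ?_ ?_ ?_
  · rw [e, e]; exact le h1
  · rw [e, e]; exact le h2
  · rw [e, e]; exact le h3
  · rw [e, e]; exact le h4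
  · rw [e, e, e, e]
    rcases h5 with ((h | h) | h) | h
    · exact .inl (lt h)
    · exact .inr (.inl (lt h))
    · exact .inr (.inr (.inl (lt h)))
    · exact .inr (.inr (.inr (lt h)))

/-- The edges (indices below `15`) and the vertices (as degenerate edges) of the product graph,
up to the choice of the copy. The edges with indices `9 + v` join two consecutive copies. -/
def cell (τ : Fin 21) : (Fin 6 × ℕ) × (Fin 6 × ℕ) :=
  ![((0, 0), (1, 0)), ((1, 0), (2, 0)), ((2, 0), (3, 0)), ((3, 0), (4, 0)), ((4, 0), (5, 0)),
    ((5, 0), (0, 0)), ((0, 0), (2, 0)), ((0, 0), (4, 0)), ((1, 0), (5, 0)),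
    ((0, 0), (0, 1)), ((1, 0), (1, 1)), ((2, 0), (2, 1)), ((3, 0), (3, 1)), ((4, 0), (4, 1)),
    ((5, 0), (5, 1)),
    ((0, 0), (0, 0)), ((1, 0), (1, 0)), ((2, 0), (2, 0)), ((3, 0), (3, 0)), ((4, 0), (4, 0)),
    ((5, 0), (5, 0))] τ

theorem cell_snd_le : ∀ τ, (cell τ).1.2 = 0 ∧ (cell τ).2.2 ≤ 1 := by decide

/-- The open segment that represents a cell in the copy `m`. -/
noncomputable def cellSegment (τ : Fin 21) (m : ℕ) : Set (ℝ × ℝ) :=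
  openSegment ℝ (nestedPos (shiftCopy m (cell τ).1)) (nestedPos (shiftCopy m (cell τ).2))

/-- The crossing pairs of cells: `τ` in a copy `m` and `τ'` in the copy `m + d`.
The first argument tells whether `m = 0`. -/
def crossingCells (outer : Bool) (τ τ' : Fin 21) (d : ℕ) : Bool :=
  if outer then τ == 9 && τ' == 8
  else (d == 0 && ((τ == 6 && τ' == 10) || (τ == 7 && τ' == 14))) ||
    (d == 1 && τ == 9 && τ' == 8)

/-- The determinant of the direction vectors of the lines `pq` and `rs`. -/
def directionDet (p q r s : ℤ × ℤ) : ℤ :=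
  (q.1 - p.1) * (s.2 - r.2) - (q.2 - p.2) * (s.1 - r.1)

/-- Two cells in copies `m` and `m + d` are separated, or they are listed as crossing and they are
not parallel. The first argument tells whether `m = 0`. -/
def cellsSeparatedOrCrossing (outer : Bool) (τ τ' : Fin 21) (d : ℕ) : Bool :=
  let p := scaledPos outer (cell τ).1
  let q := scaledPos outer (cell τ).2
  let r := scaledPos outer (shiftCopy d (cell τ').1)
  let s := scaledPos outer (shiftCopy d (cell τ').2)
  separated p q r s ||
    ((crossingCells outer τ τ' d || (d == 0 && crossingCells outer τ' τ 0)) &&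
      directionDet p q r s != 0)

theorem cellsSeparatedOrCrossing_zero : ∀ outer τ τ', τ ≠ τ' →
    cellsSeparatedOrCrossing outer τ τ' 0 = true := by
  decide +kernel

theorem cellsSeparatedOrCrossing_one : ∀ outer τ τ',
    cellsSeparatedOrCrossing outer τ τ' 1 = true := by
  decide +kernel

/-- The cell is on the positive side of some form that is small on the box `[-6, 6] ^ 2`. -/
def cellAvoidsBox (outer : Bool) (τ : Fin 21) : Bool :=
  let p := scaledPos outer (cell τ).1
  let q := scaledPos outer (cell τ).2
  [(p.2 - q.2, q.1 - p.1), (q.2 - p.2, p.1 - q.1), (0, 1), (0, -1), (1, 0), (-1, 0),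
    (1, 1), (1, -1), (-1, 1), (-1, -1)].any fun l ↦
      decide (6 * (|l.1| + |l.2|) < intForm l p) && decide (6 * (|l.1| + |l.2|) < intForm l q)

theorem cellAvoidsBox_eq_true : ∀ outer τ, cellAvoidsBox outer τ = true := by
  decide +kernel

theorem shiftCopy_shiftCopy (m d : ℕ) (x : Fin 6 × ℕ) :
    shiftCopy m (shiftCopy d x) = shiftCopy (m + d) x := by
  simp only [shiftCopy, Prod.mk.injEq, true_and]
  omega

theorem cellSegment_add (τ : Fin 21) (m : ℕ) {d : ℕ} (hd : d ≤ 1) :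
    cellSegment τ (m + d) = openSegment ℝ
      ((20 ^ (m + 2) : ℝ)⁻¹ * (scaledPos (m == 0) (shiftCopy d (cell τ).1)).1,
        (20 ^ (m + 2) : ℝ)⁻¹ * (scaledPos (m == 0) (shiftCopy d (cell τ).1)).2)
      ((20 ^ (m + 2) : ℝ)⁻¹ * (scaledPos (m == 0) (shiftCopy d (cell τ).2)).1,
        (20 ^ (m + 2) : ℝ)⁻¹ * (scaledPos (m == 0) (shiftCopy d (cell τ).2)).2) := by
  have := cell_snd_le τ
  rw [cellSegment, ← shiftCopy_shiftCopy, ← shiftCopy_shiftCopy, nestedPos_shiftCopy,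
    nestedPos_shiftCopy] <;> simp only [shiftCopy] <;> omega

theorem cellSegment_inter_of_close {τ τ' : Fin 21} {m d : ℕ} (hd : d ≤ 1) (hne : d = 0 → τ ≠ τ')
    (h : (cellSegment τ m ∩ cellSegment τ' (m + d)).Nonempty) :
    (crossingCells (m == 0) τ τ' d ∨ d = 0 ∧ crossingCells (m == 0) τ' τ 0) ∧
      (cellSegment τ m ∩ cellSegment τ' (m + d)).Subsingleton := by
  have hc : (0 : ℝ) < (20 ^ (m + 2) : ℝ)⁻¹ := by positivity
  have key : cellsSeparatedOrCrossing (m == 0) τ τ' d = true := by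
    obtain rfl | rfl : d = 0 ∨ d = 1 := by omega
    · exact cellsSeparatedOrCrossing_zero _ _ _ (hne rfl)
    · exact cellsSeparatedOrCrossing_one _ _ _
  have h0 := cellSegment_add τ m (d := 0) (by omega)
  simp only [add_zero, show ∀ x, shiftCopy 0 x = x from fun _ ↦ rfl] at h0
  rw [h0, cellSegment_add τ' m hd] at h ⊢
  simp only [cellsSeparatedOrCrossing, Bool.or_eq_true, Bool.and_eq_true, beq_iff_eq, bne_iff_ne,
    ne_eq] at key
  rcases key with key | ⟨key, hdet⟩
  · exact absurd h (Set.not_nonempty_iff_eq_empty.2 (disjoint_of_separated key hc).inter_eq)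
  · refine ⟨key, subsingleton_openSegment_inter fun h' ↦ hdet ?_⟩
    have hcc : (20 ^ (m + 2) : ℝ)⁻¹ * (20 ^ (m + 2) : ℝ)⁻¹ * (directionDet
        (scaledPos (m == 0) (cell τ).1) (scaledPos (m == 0) (cell τ).2)
        (scaledPos (m == 0) (shiftCopy d (cell τ').1))
        (scaledPos (m == 0) (shiftCopy d (cell τ').2)) : ℤ) = 0 := by
      rw [directionDet]
      push_cast
      linear_combination h'
    exact_mod_cast (mul_eq_zero.1 hcc).resolve_left (mul_pos hc hc).ne'

theorem abs_basePos_le : ∀ v, |(basePos v).1| ≤ 6 ∧ |(basePos v).2| ≤ 6 := by decide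

theorem abs_realForm_nestedPos_le (l : ℤ × ℤ) {x : Fin 6 × ℕ} {m : ℕ} (hx : m + 2 ≤ x.2) :
    |realForm l (nestedPos x)| ≤ (20 ^ (m + 2) : ℝ)⁻¹ * (6 * (|l.1| + |l.2|) : ℤ) := by
  have hx0 : ¬ (x.1 = 0 ∧ x.2 = 0) := by omega
  obtain ⟨h1, h2⟩ := abs_basePos_le x.1
  have e : realForm l (nestedPos x) = (20 ^ x.2 : ℝ)⁻¹ * (intForm l (basePos x.1) : ℤ) := by
    rw [realForm_apply, nestedPos, if_neg hx0, intForm]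
    push_cast
    ring
  have hb : |intForm l (basePos x.1)| ≤ 6 * (|l.1| + |l.2|) := by
    refine (abs_add_le _ _).trans ?_
    rw [abs_mul, abs_mul]
    nlinarith [mul_le_mul_of_nonneg_left h1 (abs_nonneg l.1),
      mul_le_mul_of_nonneg_left h2 (abs_nonneg l.2)]
  rw [e, abs_mul, abs_of_pos (by positivity)]
  refine mul_le_mul (inv_anti₀ (by positivity) (pow_le_pow_right₀ (by norm_num) hx))
    (by exact_mod_cast hb) (abs_nonneg _) (by positivity)

theorem disjoint_cellSegment_of_far (τ τ' : Fin 21) {m m' : ℕ} (h : m + 2 ≤ m') :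
    Disjoint (cellSegment τ m) (cellSegment τ' m') := by
  have hc : (0 : ℝ) < (20 ^ (m + 2) : ℝ)⁻¹ := by positivity
  obtain ⟨l, -, hl⟩ := List.any_eq_true.1 (cellAvoidsBox_eq_true (m == 0) τ)
  simp only [Bool.and_eq_true, decide_eq_true_eq] at hl
  have h0 := cellSegment_add τ m (d := 0) (by omega)
  simp only [add_zero, show ∀ x, shiftCopy 0 x = x from fun _ ↦ rfl] at h0
  have e (x : ℤ × ℤ) : realForm l ((20 ^ (m + 2) : ℝ)⁻¹ * x.1, (20 ^ (m + 2) : ℝ)⁻¹ * x.2) =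
      (20 ^ (m + 2) : ℝ)⁻¹ * (intForm l x : ℤ) := by
    rw [realForm_apply, intForm]
    push_cast
    ring
  have lt {x : Fin 6 × ℕ} {a : ℤ} (ha : 6 * (|l.1| + |l.2|) < a) :
      realForm l (nestedPos (shiftCopy m' x)) < (20 ^ (m + 2) : ℝ)⁻¹ * a :=
    ((le_abs_self _).trans (abs_realForm_nestedPos_le l (m := m)
      (by simp only [shiftCopy]; omega))).trans_lt
      (mul_lt_mul_of_pos_left (by exact_mod_cast ha) hc)
  rw [h0]
  refine (disjoint_openSegment_of_le (realForm l) ?_ ?_ ?_ ?_ (.inl ?_)).symm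
  all_goals rw [e]
  · exact (lt hl.1).le
  · exact (lt hl.2).le
  · exact (lt hl.1).le
  · exact (lt hl.2).le
  · exact lt hl.1

/-- Two distinct cells that meet are a crossing pair, and they meet in one point. -/
theorem cellSegment_inter {τ τ' : Fin 21} {m m' : ℕ} (hm : m ≤ m') (hne : m = m' → τ ≠ τ')
    (h : (cellSegment τ m ∩ cellSegment τ' m').Nonempty) :
    (m' ≤ m + 1 ∧ crossingCells (m == 0) τ τ' (m' - m) ∨ m = m' ∧ crossingCells (m == 0) τ' τ 0) ∧
      (cellSegment τ m ∩ cellSegment τ' m').Subsingleton := by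
  obtain ⟨d, rfl⟩ := Nat.exists_eq_add_of_le hm
  rcases Nat.lt_or_ge 1 d with hd | hd
  · exact absurd h (Set.not_nonempty_iff_eq_empty.2
      (disjoint_cellSegment_of_far τ τ' (by omega)).inter_eq)
  · obtain ⟨h1, h2⟩ := cellSegment_inter_of_close hd (fun h0 ↦ hne (by omega)) h
    refine ⟨?_, h2⟩
    rw [Nat.add_sub_cancel_left]
    rcases h1 with h1 | ⟨rfl, h1⟩
    · exact .inl ⟨by omega, h1⟩
    · exact .inr ⟨rfl, h1⟩

/-- The cells that represent a vertex are degenerate. -/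
theorem exists_cellSegment_eq_singleton (x : Fin 6 × ℕ) :
    ∃ τ : Fin 21, 15 ≤ τ.val ∧ (cell τ).1 = (x.1, 0) ∧ cellSegment τ x.2 = {nestedPos x} := by
  obtain ⟨τ, hτ, h⟩ : ∃ τ : Fin 21, 15 ≤ τ.val ∧ cell τ = ((x.1, 0), (x.1, 0)) := by
    generalize x.1 = v
    decide +revert
  refine ⟨τ, hτ, by rw [h], ?_⟩
  rw [cellSegment, h, openSegment_same]
  simp [shiftCopy]

theorem lt_of_crossingCells {outer : Bool} {τ τ' : Fin 21} {d : ℕ}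
    (h : crossingCells outer τ τ' d = true) : τ.val < 15 ∧ τ'.val < 15 := by
  cases outer <;>
    simp only [crossingCells, if_true, Bool.false_eq_true, if_false, Bool.or_eq_true,
      Bool.and_eq_true, beq_iff_eq] at h
  · rcases h with ⟨-, ⟨rfl, rfl⟩ | ⟨rfl, rfl⟩⟩ | ⟨⟨-, rfl⟩, rfl⟩ <;> decide
  · obtain ⟨rfl, rfl⟩ := h
    decide

theorem disjoint_cellSegment_of_degenerate {τ τ' : Fin 21} {m m' : ℕ} (hτ : 15 ≤ τ.val)
    (hne : m = m' → τ ≠ τ') : Disjoint (cellSegment τ m) (cellSegment τ' m') := by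
  rw [Set.disjoint_iff_inter_eq_empty, ← Set.not_nonempty_iff_eq_empty]
  intro h
  rcases le_total m m' with hm | hm
  · rcases (cellSegment_inter hm hne h).1 with ⟨-, h⟩ | ⟨-, h⟩
    · have := lt_of_crossingCells h
      omega
    · have := lt_of_crossingCells h
      omega
  · rw [Set.inter_comm] at h
    rcases (cellSegment_inter hm (fun e ↦ (hne e.symm).symm) h).1 with ⟨-, h⟩ | ⟨-, h⟩
    · have := lt_of_crossingCells h
      omega
    · have := lt_of_crossingCells h
      omega

theorem nestedPos_injective : Function.Injective nestedPos := by
  intro x y h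
  obtain ⟨τ, hτ, hx, hsx⟩ := exists_cellSegment_eq_singleton x
  obtain ⟨τ', -, hy, hsy⟩ := exists_cellSegment_eq_singleton y
  by_contra hne
  have := disjoint_cellSegment_of_degenerate (τ' := τ') (m := x.2) (m' := y.2) hτ fun hm e ↦ by
    subst e
    exact hne (Prod.ext (Prod.mk.inj (hx.symm.trans hy)).1 hm)
  rw [hsx, hsy, h] at this
  simp at this

/-- The pair of endpoints of a cell in the copy `m`. -/
def cellEdge (τ : Fin 21) (m : ℕ) : Sym2 (Fin 6 × ℕ) :=
  s(shiftCopy m (cell τ).1, shiftCopy m (cell τ).2)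

theorem cellSegment_eq_of_cellEdge_eq {τ : Fin 21} {m : ℕ} {u v : Fin 6 × ℕ}
    (h : s(u, v) = cellEdge τ m) : openSegment ℝ (nestedPos u) (nestedPos v) = cellSegment τ m := by
  rcases Sym2.eq_iff.1 h with ⟨rfl, rfl⟩ | ⟨rfl, rfl⟩
  · rfl
  · exact openSegment_symm _ _ _

/-- Forget the bound on the copies of a vertex of the product. -/
def copyVal {n : ℕ} (x : Fin 6 × Fin (n + 1)) : Fin 6 × ℕ := (x.1, x.2)

theorem copyVal_injective (n : ℕ) : Function.Injective (copyVal (n := n)) := by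
  intro x y h
  simp only [copyVal, Prod.mk.injEq, Fin.val_inj] at h
  exact Prod.ext h.1 h.2

instance : DecidableRel G6_110.Adj := fun u v ↦ by
  unfold G6_110
  simp only [fromEdgeSet_adj, Set.mem_insert_iff, Set.mem_singleton_iff]
  infer_instance

theorem exists_cellEdge_eq {n : ℕ} {u v : Fin 6 × Fin (n + 1)}
    (h : (G6_110 □ pathGraph (n + 1)).Adj u v) :
    ∃ (τ : Fin 21) (m : ℕ), τ.val < 15 ∧ (cell τ).2.2 + m ≤ n ∧
      s(copyVal u, copyVal v) = cellEdge τ m := by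
  obtain ⟨u, i⟩ := u
  obtain ⟨v, j⟩ := v
  have horiz : ∀ u v, G6_110.Adj u v → ∃ τ : Fin 21, τ.val < 15 ∧
      (cell τ = ((u, 0), (v, 0)) ∨ cell τ = ((v, 0), (u, 0))) := by decide
  have vert : ∀ u, ∃ τ : Fin 21, τ.val < 15 ∧ cell τ = ((u, 0), (u, 1)) := by decide
  simp only [boxProd_adj, pathGraph_adj] at h
  rcases h with ⟨h, rfl⟩ | ⟨h, rfl⟩
  · obtain ⟨τ, hτ, hc | hc⟩ := horiz u v h
    · refine ⟨τ, i, hτ, by rw [hc]; simp only; omega, ?_⟩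
      simp [cellEdge, hc, shiftCopy, copyVal]
    · refine ⟨τ, i, hτ, by rw [hc]; simp only; omega, ?_⟩
      simp [cellEdge, hc, shiftCopy, copyVal]
  · obtain ⟨τ, hτ, hc⟩ := vert u
    rcases h with h | h
    · refine ⟨τ, i, hτ, by rw [hc]; simp only; omega, ?_⟩
      simp [cellEdge, hc, shiftCopy, copyVal, ← h, add_comm]
    · refine ⟨τ, j, hτ, by rw [hc]; simp only; omega, ?_⟩
      simp [cellEdge, hc, shiftCopy, copyVal, ← h, add_comm]

/-- The straight-line drawing of `G⁶₁₁₀ □ Pₙ` with nested copies of `G⁶₁₁₀`. -/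
noncomputable def nestedDrawing (n : ℕ) : Drawing (G6_110 □ pathGraph (n + 1)) :=
  straightDrawing _ (fun x ↦ nestedPos (copyVal x))
    (nestedPos_injective.comp (copyVal_injective n)) fun u v h w hw ↦ by
      obtain ⟨τ, m, hτ, -, he⟩ := exists_cellEdge_eq h
      obtain ⟨τ', hτ', -, hs⟩ := exists_cellSegment_eq_singleton (copyVal w)
      rw [cellSegment_eq_of_cellEdge_eq he] at hw
      have := disjoint_cellSegment_of_degenerate (τ' := τ) (m := (copyVal w).2) (m' := m) hτ'
        fun _ e ↦ by subst e; omega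
      rw [hs, Set.disjoint_singleton_left] at this
      exact this hw

theorem nestedDrawing_arc {n : ℕ} (e : (G6_110 □ pathGraph (n + 1)).edgeSet) :
    ∃ (τ : Fin 21) (m : ℕ), (cell τ).2.2 + m ≤ n ∧ e.1.map copyVal = cellEdge τ m ∧
      ∀ t ∈ Set.Ioo (0 : ℝ) 1, (nestedDrawing n).arc e t ∈ cellSegment τ m := by
  obtain ⟨u, v, huv⟩ : ∃ u v, e.1 = s(u, v) := by
    induction e.1 with | _ u v
    exact ⟨u, v, rfl⟩
  have hadj : (G6_110 □ pathGraph (n + 1)).Adj u v := by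
    rw [← mem_edgeSet, ← huv]
    exact e.2
  obtain ⟨τ, m, -, hm, hc⟩ := exists_cellEdge_eq hadj
  refine ⟨τ, m, hm, by rw [huv, Sym2.map_mk, hc], fun t ht ↦ ?_⟩
  rw [← cellSegment_eq_of_cellEdge_eq hc]
  unfold nestedDrawing
  exact mem_openSegment_of_straightDrawing (P := fun x ↦ nestedPos (copyVal x)) huv ht

/-- The crossing pairs of edges of the nested drawing. -/
def nestedCrossing (x : ℕ × ℕ) : Sym2 (Sym2 (Fin 6 × ℕ)) :=
  if x.2 = 0 then
    if x.1 = 0 then s(cellEdge 9 0, cellEdge 8 0) else s(cellEdge 6 x.1, cellEdge 10 x.1)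
  else if x.2 = 1 then s(cellEdge 9 x.1, cellEdge 8 (x.1 + 1))
  else s(cellEdge 7 x.1, cellEdge 14 x.1)

theorem cellEdge_mem_of_crossingCells {n m m' : ℕ} {τ τ' : Fin 21} (hm : m ≤ m') (hm' : m' ≤ m + 1)
    (h : crossingCells (m == 0) τ τ' (m' - m) = true) (hτ : (cell τ).2.2 + m ≤ n)
    (hτ' : (cell τ').2.2 + m' ≤ n) :
    s(cellEdge τ m, cellEdge τ' m') ∈
      (((Finset.range n ×ˢ Finset.range 3).erase (0, 2)).image nestedCrossing : Finset _) := by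
  have c9 : (cell 9).2.2 = 1 := rfl
  have c10 : (cell 10).2.2 = 1 := rfl
  have c14 : (cell 14).2.2 = 1 := rfl
  have main (x : ℕ × ℕ) (h1 : x.1 < n) (h2 : x.2 < 3) (h3 : x.1 = 0 → x.2 ≠ 2) :
      nestedCrossing x ∈
        (((Finset.range n ×ˢ Finset.range 3).erase (0, 2)).image nestedCrossing : Finset _) := by
    refine Finset.mem_image_of_mem _ (Finset.mem_erase.2 ⟨?_, ?_⟩)
    · rintro rfl
      exact h3 rfl rfl
    · simp [h1, h2]
  rcases Nat.eq_zero_or_pos m with rfl | h0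
  · simp only [crossingCells, beq_self_eq_true, if_true, Bool.and_eq_true, beq_iff_eq] at h
    obtain ⟨rfl, rfl⟩ := h
    obtain rfl | rfl : m' = 0 ∨ m' = 1 := by omega
    · exact main (0, 0) (by simp only; omega) (by simp) (by simp)
    · exact main (0, 1) (by simp only; omega) (by simp) (by simp)
  · have hb : (m == 0) = false := by simp [h0.ne']
    simp only [crossingCells, hb, Bool.false_eq_true, if_false, Bool.or_eq_true,
      Bool.and_eq_true, beq_iff_eq] at h
    rcases h with ⟨hd, ⟨rfl, rfl⟩ | ⟨rfl, rfl⟩⟩ | ⟨⟨hd, rfl⟩, rfl⟩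
    · obtain rfl : m' = m := by omega
      have := main (m', 0) (by simp only; omega) (by simp) (by simp)
      simpa only [nestedCrossing, h0.ne', if_true, if_false] using this
    · obtain rfl : m' = m := by omega
      exact main (m', 2) (by simp only; omega) (by simp) (by simp only; omega)
    · obtain rfl : m' = m + 1 := by omega
      exact main (m, 1) (by simp only; omega) (by simp) (by simp)

theorem nestedDrawing_crossings {n : ℕ}
    {e f : (G6_110 □ pathGraph (n + 1)).edgeSet} (hne : e ≠ f) {z : ℝ × ℝ}
    (he : ∃ t ∈ Set.Ioo (0 : ℝ) 1, (nestedDrawing n).arc e t = z)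
    (hf : ∃ t ∈ Set.Ioo (0 : ℝ) 1, (nestedDrawing n).arc f t = z) :
    s(e.1.map copyVal, f.1.map copyVal) ∈
      (((Finset.range n ×ˢ Finset.range 3).erase (0, 2)).image nestedCrossing : Finset _) ∧
    ∀ w, (∃ t ∈ Set.Ioo (0 : ℝ) 1, (nestedDrawing n).arc e t = w) →
      (∃ t ∈ Set.Ioo (0 : ℝ) 1, (nestedDrawing n).arc f t = w) → w = z := by
  obtain ⟨τ, m, hm, hτ, hmem⟩ := nestedDrawing_arc e
  obtain ⟨τ', m', hm', hτ', hmem'⟩ := nestedDrawing_arc f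
  have hne' : m = m' → τ ≠ τ' := by
    rintro rfl rfl
    exact hne (Subtype.ext (Sym2.map.injective (copyVal_injective n) (hτ.trans hτ'.symm)))
  have hz (w : ℝ × ℝ) (he : ∃ t ∈ Set.Ioo (0 : ℝ) 1, (nestedDrawing n).arc e t = w)
      (hf : ∃ t ∈ Set.Ioo (0 : ℝ) 1, (nestedDrawing n).arc f t = w) :
      w ∈ cellSegment τ m ∩ cellSegment τ' m' := by
    obtain ⟨t, ht, rfl⟩ := he
    obtain ⟨t', ht', h⟩ := hf
    exact ⟨hmem t ht, h ▸ hmem' t' ht'⟩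
  rw [hτ, hτ']
  rcases le_total m m' with hle | hle
  · obtain ⟨h1, h2⟩ := cellSegment_inter hle hne' ⟨z, hz z he hf⟩
    refine ⟨?_, fun w h h' ↦ h2 (hz w h h') (hz z he hf)⟩
    rcases h1 with ⟨h, h1⟩ | ⟨rfl, h1⟩
    · exact cellEdge_mem_of_crossingCells hle h h1 hm hm'
    · rw [Sym2.eq_swap]
      exact cellEdge_mem_of_crossingCells le_rfl (Nat.le_succ _) (by rwa [Nat.sub_self]) hm' hm
  · obtain ⟨h1, h2⟩ := cellSegment_inter hle (fun h ↦ (hne' h.symm).symm)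
      ⟨z, Set.inter_comm _ _ ▸ hz z he hf⟩
    refine ⟨?_, fun w h h' ↦ h2 (hz w h h').symm (hz z he hf).symm⟩
    rcases h1 with ⟨h, h1⟩ | ⟨rfl, h1⟩
    · rw [Sym2.eq_swap]
      exact cellEdge_mem_of_crossingCells hle h h1 hm' hm
    · exact cellEdge_mem_of_crossingCells le_rfl (Nat.le_succ _) (by rwa [Nat.sub_self]) hm hm'

theorem exists_drawing_ncard_crossings_le {n : ℕ} (hn : 1 ≤ n) :
    ∃ D : Drawing (G6_110 □ pathGraph (n + 1)),
      D.crossings.Finite ∧ D.crossings.ncard ≤ 3 * n - 1 := by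
  set T : Finset (Sym2 (Sym2 (Fin 6 × ℕ))) :=
    ((Finset.range n ×ˢ Finset.range 3).erase (0, 2)).image nestedCrossing
  have hT : T.card ≤ 3 * n - 1 := by
    refine Finset.card_image_le.trans ?_
    rw [Finset.card_erase_of_mem (by simp; omega), Finset.card_product, Finset.card_range,
      Finset.card_range, mul_comm]
  set F : Sym2 (G6_110 □ pathGraph (n + 1)).edgeSet × (ℝ × ℝ) → Sym2 (Sym2 (Fin 6 × ℕ)) :=
    fun x ↦ x.1.map fun e ↦ e.1.map copyVal
  have hFinj : Function.Injective
      fun e : (G6_110 □ pathGraph (n + 1)).edgeSet ↦ e.1.map copyVal :=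
    fun e f h ↦ Subtype.ext (Sym2.map.injective (copyVal_injective n) h)
  have hmaps : Set.MapsTo F (nestedDrawing n).crossings T := by
    rintro ⟨-, z⟩ ⟨e, f, hne, rfl, he, hf⟩
    exact (nestedDrawing_crossings hne he hf).1
  have hinj : Set.InjOn F (nestedDrawing n).crossings := by
    rintro ⟨-, z⟩ ⟨e, f, hne, rfl, he, hf⟩ ⟨-, w⟩ ⟨e', f', -, rfl, he', hf'⟩ h
    have h' : s(e, f) = s(e', f') := Sym2.map.injective hFinj h
    refine Prod.ext h' ?_
    rcases Sym2.eq_iff.1 h' with ⟨rfl, rfl⟩ | ⟨rfl, rfl⟩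
    · exact ((nestedDrawing_crossings hne he hf).2 w he' hf').symm
    · exact ((nestedDrawing_crossings hne he hf).2 w hf' he').symm
  refine ⟨nestedDrawing n, Set.Finite.of_finite_image (T.finite_toSet.subset hmaps.image_subset)
    hinj, ?_⟩
  calc (nestedDrawing n).crossings.ncard ≤ (T : Set _).ncard :=
        Set.ncard_le_ncard_of_injOn F (fun _ h ↦ hmaps h) hinj
    _ = T.card := Set.ncard_coe_finset T
    _ ≤ 3 * n - 1 := hT

/-! ### Routes in a drawing -/

/-- The pairs of consecutive entries of a list. -/
def consecutivePairs {V : Type*} : List V → List (Sym2 V)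
  | [] => []
  | [_] => []
  | a :: b :: l => s(a, b) :: consecutivePairs (b :: l)

theorem consecutivePairs_map {V W : Type*} (f : V → W) :
    ∀ l : List V, consecutivePairs (l.map f) = (consecutivePairs l).map (Sym2.map f)
  | [] => rfl
  | [_] => rfl
  | a :: b :: l => by
    have := consecutivePairs_map f (b :: l)
    simp only [List.map_cons] at this
    simp only [consecutivePairs, List.map_cons, this, Sym2.map_mk]

theorem mem_of_mem_consecutivePairs {V : Type*} {x : V} {e : Sym2 V} (hx : x ∈ e) :
    ∀ {l : List V}, e ∈ consecutivePairs l → x ∈ l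
  | [], h => by simp [consecutivePairs] at h
  | [_], h => by simp [consecutivePairs] at h
  | a :: b :: l, h => by
    rcases List.mem_cons.1 h with rfl | h
    · rcases Sym2.mem_iff.1 hx with rfl | rfl <;> simp
    · exact List.mem_cons_of_mem _ (mem_of_mem_consecutivePairs hx h)

/-- The points of a drawing that lie on the route through the vertices of a list. -/
def Drawing.routeImage {V : Type*} {G : SimpleGraph V} (D : Drawing G) (l : List V) :
    Set (ℝ × ℝ) :=
  {z | (∃ u ∈ l, D.vertexMap u = z) ∨
    ∃ e : G.edgeSet, e.1 ∈ consecutivePairs l ∧ ∃ t ∈ Set.Ioo (0 : ℝ) 1, D.arc e t = z}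

theorem Drawing.joinedIn_routeImage {V : Type*} {G : SimpleGraph V} (D : Drawing G) (a : V)
    (l : List V) (h : (a :: l).IsChain G.Adj) :
    JoinedIn (D.routeImage (a :: l)) (D.vertexMap a)
      (D.vertexMap ((a :: l).getLast (List.cons_ne_nil _ _))) := by
  induction l generalizing a with
  | nil => exact JoinedIn.refl (.inl ⟨a, by simp, rfl⟩)
  | cons b l ih =>
    rw [List.isChain_cons_cons] at h
    have hsub : D.routeImage (b :: l) ⊆ D.routeImage (a :: b :: l) := by
      rintro z (⟨u, hu, rfl⟩ | ⟨e, he, hz⟩)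
      · exact .inl ⟨u, List.mem_cons_of_mem _ hu, rfl⟩
      · exact .inr ⟨e, List.mem_cons_of_mem _ he, hz⟩
    have hlast := (ih b h.2).mono hsub
    rw [List.getLast_cons (List.cons_ne_nil b l)]
    refine JoinedIn.trans ?_ hlast
    let e : G.edgeSet := ⟨s(a, b), h.1⟩
    obtain ⟨u, v, huv, h0, h1⟩ := D.arc_endpoints e
    have hmem : ∀ w ∈ s(u, v), w ∈ a :: b :: l := by
      intro w hw
      rw [← huv] at hw
      rcases Sym2.mem_iff.1 hw with rfl | rfl <;> simp
    have hj : JoinedIn (D.routeImage (a :: b :: l)) (D.vertexMap u) (D.vertexMap v) := by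
      refine JoinedIn.ofLine (D.arc_continuousOn e) h0 h1 ?_
      rintro _ ⟨t, ⟨ht0, ht1⟩, rfl⟩
      rcases ht0.eq_or_lt with rfl | ht0
      · exact .inl ⟨u, hmem u (by simp), h0.symm⟩
      rcases ht1.eq_or_lt with rfl | ht1
      · exact .inl ⟨v, hmem v (by simp), h1.symm⟩
      exact .inr ⟨e, List.mem_cons_self, t, ⟨ht0, ht1⟩, rfl⟩
    rcases Sym2.eq_iff.1 huv with ⟨rfl, rfl⟩ | ⟨rfl, rfl⟩
    · exact hj
    · exact hj.symm

/-- Two vertex-disjoint routes that meet contain two edges that cross. -/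
theorem Drawing.exists_mem_crossings {V : Type*} {G : SimpleGraph V} (D : Drawing G) {l l' : List V}
    (hd : l.Disjoint l') (h : (D.routeImage l ∩ D.routeImage l').Nonempty) :
    ∃ (e f : G.edgeSet) (z : ℝ × ℝ), (s(e, f), z) ∈ D.crossings ∧
      e.1 ∈ consecutivePairs l ∧ f.1 ∈ consecutivePairs l' := by
  obtain ⟨z, ⟨u, hu, rfl⟩ | ⟨e, he, t, ht, rfl⟩, ⟨v, hv, h⟩ | ⟨f, hf, s, hs, h⟩⟩ := h
  · exact (hd hu (D.vertexMap_injective h ▸ hv)).elim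
  · exact (D.arc_avoids_vertices f s hs u h).elim
  · exact (D.arc_avoids_vertices e t ht v h.symm).elim
  · refine ⟨e, f, _, ⟨e, f, ?_, rfl, ⟨t, ht, rfl⟩, s, hs, h⟩, he, hf⟩
    rintro rfl
    have hx := Sym2.out_fst_mem e.1
    exact hd (mem_of_mem_consecutivePairs hx he) (mem_of_mem_consecutivePairs hx hf)

/-! ### Subdivisions of `K₃,₃` in three consecutive copies -/

/-- The route between two vertices of the copy `d` of `G⁶₁₁₀`, through `3` for the pair `2`, `4`. -/
def copyRoute (u v : Fin 6) (d : ℕ) : List (Fin 6 × ℕ) :=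
  if u = v then [(u, d)]
  else if (u = 2 ∧ v = 4) ∨ (u = 4 ∧ v = 2) then [(u, d), (3, d), (v, d)]
  else [(u, d), (v, d)]

/-- The route between two vertices in the copies `0`, `1`, `2`, one of which is in the copy `1`. -/
def route (u v : Fin 6 × ℕ) : List (Fin 6 × ℕ) :=
  if u.2 ≠ 1 then copyRoute u.1 v.1 u.2 ++ [(v.1, 1)]
  else if v.2 ≠ 1 then (u.1, 1) :: copyRoute u.1 v.1 v.2
  else copyRoute u.1 v.1 1

/-- One side of each of several copies of `K₃,₃`. -/
def leftSide : Fin 12 → Fin 3 → Fin 6 × ℕ :=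
  ![![(1, 1), (4, 1), (0, 0)], ![(1, 1), (4, 1), (0, 1)],
    ![(1, 1), (4, 1), (0, 2)], ![(1, 1), (4, 1), (0, 1)],
    ![(0, 0), (0, 2), (4, 1)], ![(4, 0), (4, 2), (0, 1)],
    ![(0, 0), (0, 2), (1, 1)], ![(1, 0), (1, 2), (0, 1)],
    ![(0, 0), (0, 2), (5, 1)], ![(5, 0), (5, 2), (0, 1)],
    ![(0, 0), (0, 2), (2, 1)], ![(2, 0), (2, 2), (0, 1)]]

/-- The other side of each of these copies of `K₃,₃`. -/
def rightSide : Fin 12 → Fin 3 → Fin 6 × ℕ :=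
  ![![(2, 1), (5, 1), (0, 1)], ![(2, 1), (5, 1), (0, 0)],
    ![(2, 1), (5, 1), (0, 1)], ![(2, 1), (5, 1), (0, 2)],
    ![(2, 1), (5, 1), (0, 1)], ![(2, 1), (5, 1), (4, 1)],
    ![(2, 1), (5, 1), (0, 1)], ![(2, 1), (5, 1), (1, 1)],
    ![(1, 1), (4, 1), (0, 1)], ![(1, 1), (4, 1), (5, 1)],
    ![(1, 1), (4, 1), (0, 1)], ![(1, 1), (4, 1), (2, 1)]]

/-- The route that represents an edge of a copy of `K₃,₃`. -/
def sideRoute (κ : Fin 12) (a b : Fin 3) : List (Fin 6 × ℕ) := route (leftSide κ a) (rightSide κ b)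

/-- Adjacency in the product of `G⁶₁₁₀` and an infinite path. -/
def RelAdj (x y : Fin 6 × ℕ) : Prop :=
  (G6_110.Adj x.1 y.1 ∧ x.2 = y.2) ∨ ((x.2 + 1 = y.2 ∨ y.2 + 1 = x.2) ∧ x.1 = y.1)

instance : DecidableRel RelAdj := fun _ _ ↦ inferInstanceAs (Decidable (_ ∨ _))

theorem isChain_sideRoute : ∀ κ a b, (sideRoute κ a b).IsChain RelAdj := by
  decide +kernel

theorem head?_sideRoute : ∀ κ a b, (sideRoute κ a b).head? = some (leftSide κ a) := by
  decide +kernel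

theorem getLast?_sideRoute : ∀ κ a b, (sideRoute κ a b).getLast? = some (rightSide κ b) := by
  decide +kernel

theorem disjoint_sideRoute : ∀ κ a b a' b', a ≠ a' → b ≠ b' →
    ∀ x ∈ sideRoute κ a b, x ∉ sideRoute κ a' b' := by
  decide +kernel

/-- The copies of `K₃,₃` that are used in a copy of `G⁶₁₁₀`. The first argument is `1` for the
first copy, `2` for the last one, and `0` otherwise. -/
def select (c : Fin 3) (k : ℕ) : Fin 12 :=
  if c = 1 then if k % 2 = 0 then 2 else 3
  else if c = 2 then if k % 2 = 0 then 0 else 1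
  else Fin.ofNat 12 k

/-- The number of copies of `K₃,₃`, with multiplicity, that are used in a copy of `G⁶₁₁₀`. -/
def selectCount : Fin 3 → ℕ := ![12, 4, 4]

theorem snd_le_of_mem_sideRoute : ∀ κ a b, ∀ x ∈ sideRoute κ a b, x.2 ≤ 2 ∧
    ((κ = 2 ∨ κ = 3) → 1 ≤ x.2) ∧ ((κ = 0 ∨ κ = 1) → x.2 ≤ 1) := by
  decide +kernel

/-- The pairs of edges on non-adjacent routes of a copy of `K₃,₃`. -/
def nonadjacentPairs (κ : Fin 12) : List (Sym2 (Fin 6 × ℕ) × Sym2 (Fin 6 × ℕ)) :=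
  (List.finRange 3).flatMap fun a ↦ (List.finRange 3).flatMap fun b ↦
    (List.finRange 3).flatMap fun a' ↦ (List.finRange 3).flatMap fun b' ↦
      if a ≠ a' ∧ b ≠ b' then
        consecutivePairs (sideRoute κ a b) ×ˢ consecutivePairs (sideRoute κ a' b')
      else []

theorem mem_nonadjacentPairs {κ : Fin 12} {p : Sym2 (Fin 6 × ℕ) × Sym2 (Fin 6 × ℕ)} :
    p ∈ nonadjacentPairs κ ↔ ∃ a b a' b', (a ≠ a' ∧ b ≠ b') ∧
      p.1 ∈ consecutivePairs (sideRoute κ a b) ∧ p.2 ∈ consecutivePairs (sideRoute κ a' b') := by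
  simp only [nonadjacentPairs, List.mem_flatMap, List.mem_finRange, true_and]
  refine exists_congr fun a ↦ exists_congr fun b ↦ exists_congr fun a' ↦ exists_congr fun b' ↦ ?_
  by_cases h : a ≠ a' ∧ b ≠ b'
  · rw [if_pos h, and_iff_right h]
    exact List.pair_mem_product
  · simp [h]

theorem swap_mem_nonadjacentPairs {κ : Fin 12} {p : Sym2 (Fin 6 × ℕ) × Sym2 (Fin 6 × ℕ)}
    (h : p ∈ nonadjacentPairs κ) : p.swap ∈ nonadjacentPairs κ := by
  obtain ⟨a, b, a', b', ⟨h1, h2⟩, h3, h4⟩ := mem_nonadjacentPairs.1 h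
  exact mem_nonadjacentPairs.2 ⟨a', b', a, b, ⟨h1.symm, h2.symm⟩, h4, h3⟩

/-- The sum of the copies of the endpoints of an edge. -/
def edgeLevel (e : Sym2 (Fin 6 × ℕ)) : ℕ :=
  Sym2.lift ⟨fun u v ↦ u.2 + v.2, fun _ _ ↦ add_comm _ _⟩ e

/-- A number that identifies a vertex in the copies `0`, `1`, `2`. -/
def vertexCode (u : Fin 6 × ℕ) : ℕ := u.1.val + 6 * u.2

/-- A number that identifies an edge in the copies `0`, `1`, `2`. -/
def edgeCode (e : Sym2 (Fin 6 × ℕ)) : ℕ :=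
  Sym2.lift ⟨fun u v ↦ 18 * min (vertexCode u) (vertexCode v) + max (vertexCode u) (vertexCode v),
    fun u v ↦ by
      simp only [min_comm (vertexCode u), max_comm (vertexCode u)]⟩ e

/-- A number that identifies a pair of edges in the copies `0`, `1`, `2`. -/
def pairCode (p : Sym2 (Fin 6 × ℕ) × Sym2 (Fin 6 × ℕ)) : ℕ := 324 * edgeCode p.1 + edgeCode p.2

/-- The number whose binary digits indicate the elements of a list. -/
def bitmask (l : List ℕ) : ℕ := l.foldr (fun c m ↦ m ||| 1 <<< c) 0

theorem testBit_bitmask {c : ℕ} {l : List ℕ} (h : c ∈ l) : (bitmask l).testBit c = true := by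
  induction l with
  | nil => simp at h
  | cons b l ih =>
    rw [bitmask, List.foldr_cons, Nat.testBit_or, ← bitmask]
    rcases List.mem_cons.1 h with rfl | h
    · simp [Nat.testBit_shiftLeft]
    · simp [ih h]

/-- The set of non-adjacent pairs, as a number. -/
def pairMask (κ : Fin 12) : ℕ := bitmask ((nonadjacentPairs κ).map pairCode)

theorem testBit_pairMask {κ : Fin 12} {p : Sym2 (Fin 6 × ℕ) × Sym2 (Fin 6 × ℕ)}
    (h : p ∈ nonadjacentPairs κ) : (pairMask κ).testBit (pairCode p) = true :=
  testBit_bitmask (List.mem_map_of_mem h)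

/-- The pairs of levels that also occur for the same edges in a neighbouring copy. -/
def sharedLevels : List (ℕ × ℕ) := [(0, 2), (2, 0), (2, 4), (4, 2)]

/-- The pairs of levels of non-adjacent pairs of edges. -/
def pairLevels : List (ℕ × ℕ) :=
  sharedLevels ++ [(2, 2), (2, 1), (1, 2), (2, 3), (3, 2), (1, 3), (3, 1), (0, 3), (3, 0), (1, 4),
    (4, 1), (0, 4), (4, 0)]

theorem nonadjacentPairs_bound : ∀ c, ∀ k < selectCount c, ∀ p ∈ nonadjacentPairs (select c k),
    (edgeLevel p.1, edgeLevel p.2) ∈ pairLevels ∧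
    Nat.count (fun k' ↦ (pairMask (select c k')).testBit (pairCode p) = true) (selectCount c) ≤
      if (edgeLevel p.1, edgeLevel p.2) ∈ sharedLevels then 2 else 4 := by
  decide +kernel

/-- The vertex `x` of the copies `0`, `1`, `2`, moved to the copies `i - 1`, `i`, `i + 1`. -/
def place (n i : ℕ) (x : Fin 6 × ℕ) : Fin 6 × Fin (n + 1) := (x.1, Fin.ofNat (n + 1) (i + x.2 - 1))

/-- The vertex `x` of the copies `i - 1`, `i`, `i + 1`, moved to the copies `0`, `1`, `2`. -/
def unplace {n : ℕ} (i : ℕ) (x : Fin 6 × Fin (n + 1)) : Fin 6 × ℕ := (x.1, x.2 + 1 - i)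

/-- The condition for the vertex `x` to exist when it is moved around the copy `i`. -/
def InRange (n i : ℕ) (x : Fin 6 × ℕ) : Prop := 1 ≤ i + x.2 ∧ i + x.2 ≤ n + 1

theorem val_place {n i : ℕ} {x : Fin 6 × ℕ} (hx : InRange n i x) :
    (place n i x).2.val = i + x.2 - 1 := by
  obtain ⟨h1, h2⟩ := hx
  exact Nat.mod_eq_of_lt (by omega)

theorem unplace_place {n i : ℕ} {x : Fin 6 × ℕ} (hx : InRange n i x) :
    unplace i (place n i x) = x := by
  refine Prod.ext rfl ?_
  simp only [unplace, val_place hx]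
  obtain ⟨h1, h2⟩ := hx
  omega

theorem adj_place {n i : ℕ} {x y : Fin 6 × ℕ} (hx : InRange n i x) (hy : InRange n i y)
    (h : RelAdj x y) : (G6_110 □ pathGraph (n + 1)).Adj (place n i x) (place n i y) := by
  simp only [boxProd_adj, pathGraph_adj, val_place hx, val_place hy]
  obtain ⟨hx1, hx2⟩ := hx
  obtain ⟨hy1, hy2⟩ := hy
  rcases h with ⟨h, e⟩ | ⟨h, e⟩
  · refine .inl ⟨h, ?_⟩
    simp only [place, e]
  · exact .inr ⟨by omega, e⟩

theorem isChain_map_place {n i : ℕ} {l : List (Fin 6 × ℕ)} (hr : ∀ x ∈ l, InRange n i x)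
    (h : l.IsChain RelAdj) : (l.map (place n i)).IsChain (G6_110 □ pathGraph (n + 1)).Adj := by
  induction l with
  | nil => exact .nil
  | cons a l ih =>
    cases l with
    | nil => exact .singleton _
    | cons b l =>
      rw [List.isChain_cons_cons] at h
      simp only [List.map_cons, List.isChain_cons_cons] at ih ⊢
      exact ⟨adj_place (hr _ (by simp)) (hr _ (by simp)) h.1,
        ih (fun x hx ↦ hr x (List.mem_cons_of_mem _ hx)) h.2⟩

theorem joinedIn_routeImage_place {n i : ℕ} (D : Drawing (G6_110 □ pathGraph (n + 1)))
    {l : List (Fin 6 × ℕ)} {u v : Fin 6 × ℕ} (hr : ∀ x ∈ l, InRange n i x) (h : l.IsChain RelAdj)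
    (hu : l.head? = some u) (hv : l.getLast? = some v) :
    JoinedIn (D.routeImage (l.map (place n i))) (D.vertexMap (place n i u))
      (D.vertexMap (place n i v)) := by
  cases l with
  | nil => simp at hu
  | cons a l =>
    obtain rfl : a = u := by simpa using hu
    have hlast : ((a :: l).map (place n i)).getLast (by simp) = place n i v := by
      rw [List.getLast_map]
      rw [List.getLast?_eq_getLast_of_ne_nil (List.cons_ne_nil _ _), Option.some_inj] at hv
      rw [hv]
    have := D.joinedIn_routeImage (place n i a) (l.map (place n i)) (isChain_map_place hr h)
    rw [← hlast]
    exact this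

theorem unplace_of_mem_consecutivePairs {n i : ℕ} {l : List (Fin 6 × ℕ)}
    (hr : ∀ x ∈ l, InRange n i x) {e : Sym2 (Fin 6 × Fin (n + 1))}
    (he : e ∈ consecutivePairs (l.map (place n i))) :
    e.map (unplace i) ∈ consecutivePairs l ∧
      edgeLevel (e.map (unplace i)) + 2 * i = edgeLevel (e.map copyVal) + 2 := by
  rw [consecutivePairs_map] at he
  obtain ⟨e', he', rfl⟩ := List.mem_map.1 he
  clear he
  induction e' with | _ u v
  have hu := hr u (mem_of_mem_consecutivePairs (Sym2.mem_mk_left u v) he')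
  have hv := hr v (mem_of_mem_consecutivePairs (Sym2.mem_mk_right u v) he')
  simp only [Sym2.map_mk, unplace_place hu, unplace_place hv]
  refine ⟨he', ?_⟩
  simp only [edgeLevel, Sym2.lift_mk, copyVal, val_place hu, val_place hv]
  obtain ⟨hu1, hu2⟩ := hu
  obtain ⟨hv1, hv2⟩ := hv
  omega

/-- The kind of the copy `i`, as used in `select`. -/
def copyKind (n i : ℕ) : Fin 3 := if i = 0 then 1 else if i = n then 2 else 0

theorem inRange_of_mem_sideRoute {n i : ℕ} (hn : 1 ≤ n) (hi : i ≤ n) {k : ℕ} {a b : Fin 3}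
    {x : Fin 6 × ℕ} (hx : x ∈ sideRoute (select (copyKind n i) k) a b) : InRange n i x := by
  obtain ⟨h1, h2, h3⟩ := snd_le_of_mem_sideRoute _ _ _ _ hx
  unfold InRange
  by_cases h0 : i = 0
  · have hκ : copyKind n i = 1 := if_pos h0
    have := h2 (by
      rw [hκ, select, if_pos rfl]
      split_ifs <;> simp)
    omega
  by_cases hin : i = n
  · have hκ : copyKind n i = 2 := by rw [copyKind, if_neg h0, if_pos hin]
    have := h3 (by
      rw [hκ, select, if_neg (by decide), if_pos rfl]
      split_ifs <;> simp)
    omega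
  · omega

/-- The edges `e`, `f` form a non-adjacent pair of the `k`-th copy of `K₃,₃` around the copy `i`. -/
def IsHit (n i k : ℕ) (e f : Sym2 (Fin 6 × Fin (n + 1))) : Prop :=
  (e.map (unplace i), f.map (unplace i)) ∈ nonadjacentPairs (select (copyKind n i) k) ∧
    edgeLevel (e.map (unplace i)) + 2 * i = edgeLevel (e.map copyVal) + 2 ∧
    edgeLevel (f.map (unplace i)) + 2 * i = edgeLevel (f.map copyVal) + 2

theorem IsHit.symm {n i k : ℕ} {e f : Sym2 (Fin 6 × Fin (n + 1))} (h : IsHit n i k e f) :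
    IsHit n i k f e :=
  ⟨swap_mem_nonadjacentPairs h.1, h.2.2, h.2.1⟩

theorem exists_isHit {n i : ℕ} (hn : 1 ≤ n) (hi : i ≤ n) (k : ℕ)
    (D : Drawing (G6_110 □ pathGraph (n + 1))) :
    ∃ x ∈ D.crossings, ∃ e f, x.1 = s(e, f) ∧ IsHit n i k e.1 f.1 := by
  set κ := select (copyKind n i) k with hκ
  have hr (a b : Fin 3) : ∀ x ∈ sideRoute κ a b, InRange n i x := fun x hx ↦
    inRange_of_mem_sideRoute hn hi hx
  obtain ⟨a, b, a', b', ha, hb, h⟩ := exists_nonadjacent_inter_nonempty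
    (fun a ↦ D.vertexMap (place n i (leftSide κ a)))
    (fun b ↦ D.vertexMap (place n i (rightSide κ b)))
    (fun a b ↦ D.routeImage ((sideRoute κ a b).map (place n i))) fun a b ↦
      joinedIn_routeImage_place D (hr a b) (isChain_sideRoute κ a b) (head?_sideRoute κ a b)
        (getLast?_sideRoute κ a b)
  have hd : ((sideRoute κ a b).map (place n i)).Disjoint
      ((sideRoute κ a' b').map (place n i)) := by
    intro _ h1 h2
    obtain ⟨x, hx, rfl⟩ := List.mem_map.1 h1
    obtain ⟨y, hy, hxy⟩ := List.mem_map.1 h2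
    have := congrArg (unplace i) hxy
    rw [unplace_place (hr _ _ _ hx), unplace_place (hr _ _ _ hy)] at this
    subst this
    exact disjoint_sideRoute κ a b a' b' ha hb _ hx hy
  obtain ⟨e, f, z, hz, he, hf⟩ := D.exists_mem_crossings hd h
  obtain ⟨he1, he2⟩ := unplace_of_mem_consecutivePairs (hr a b) he
  obtain ⟨hf1, hf2⟩ := unplace_of_mem_consecutivePairs (hr a' b') hf
  exact ⟨_, hz, e, f, rfl, mem_nonadjacentPairs.2 ⟨a, b, a', b', ⟨ha, hb⟩, he1, hf1⟩, he2, hf2⟩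

/-! ### Counting -/

/-- The copies of `K₃,₃` in the product, as pairs of a copy of `G⁶₁₁₀` and an index. -/
def hitIndices (n : ℕ) : Finset (ℕ × ℕ) :=
  (Finset.range (n + 1)).biUnion fun i ↦ {i} ×ˢ Finset.range (selectCount (copyKind n i))

theorem mem_hitIndices {n : ℕ} {x : ℕ × ℕ} :
    x ∈ hitIndices n ↔ x.1 ≤ n ∧ x.2 < selectCount (copyKind n x.1) := by
  simp only [hitIndices, Finset.mem_biUnion, Finset.mem_range, Finset.mem_product,
    Finset.mem_singleton, Nat.lt_succ_iff]
  constructor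
  · rintro ⟨i, hi, rfl, h⟩
    exact ⟨hi, h⟩
  · rintro ⟨h1, h2⟩
    exact ⟨_, h1, rfl, h2⟩

theorem card_hitIndices {n : ℕ} (hn : 1 ≤ n) : (hitIndices n).card = 4 * (3 * n - 1) := by
  rw [hitIndices, Finset.card_biUnion]
  · obtain ⟨n, rfl⟩ := Nat.exists_eq_add_of_le' hn
    simp only [Finset.card_product, Finset.card_singleton, Finset.card_range, one_mul]
    rw [Finset.sum_range_succ, Finset.sum_range_succ']
    have hmid : ∀ i ∈ Finset.range n, selectCount (copyKind (n + 1) (i + 1)) = 12 := by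
      intro i hi
      have := Finset.mem_range.1 hi
      rw [copyKind, if_neg (by omega), if_neg (by omega)]
      rfl
    rw [Finset.sum_congr rfl hmid]
    simp [copyKind, selectCount]
    omega
  · intro i _ j _ hij
    rw [Function.onFun, Finset.disjoint_left]
    rintro x hx hx'
    simp only [Finset.mem_product, Finset.mem_singleton] at hx hx'
    exact hij (hx.1.symm.trans hx'.1)

theorem IsHit.card_le {n i k : ℕ} {e f : Sym2 (Fin 6 × Fin (n + 1))} (h : IsHit n i k e f)
    (hk : k < selectCount (copyKind n i)) (S : Finset ℕ)
    (hS : ∀ k' ∈ S, k' < selectCount (copyKind n i) ∧ IsHit n i k' e f) :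
    S.card ≤ if (edgeLevel (e.map (unplace i)), edgeLevel (f.map (unplace i))) ∈ sharedLevels
      then 2 else 4 := by
  refine le_trans ?_ (nonadjacentPairs_bound _ k hk _ h.1).2
  rw [Nat.count_eq_card_filter_range]
  refine Finset.card_le_card fun k' hk' ↦ ?_
  rw [Finset.mem_filter, Finset.mem_range]
  exact ⟨(hS k' hk').1, testBit_pairMask (hS k' hk').2.1⟩

theorem pairLevels_parallel : ∀ p ∈ pairLevels, ∀ q ∈ pairLevels,
    p.1 + q.2 = p.2 + q.1 ∧ p.1 % 2 = q.1 % 2 → p ≠ q → p ∈ sharedLevels ∧ q ∈ sharedLevels ∧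
      ∀ r ∈ pairLevels, p.1 + r.2 = p.2 + r.1 ∧ p.1 % 2 = r.1 % 2 → r = p ∨ r = q := by
  decide +kernel

theorem card_isHit_le {n : ℕ} (e f : Sym2 (Fin 6 × Fin (n + 1))) (S : Finset (ℕ × ℕ))
    (hS : ∀ x ∈ S, x ∈ hitIndices n ∧ IsHit n x.1 x.2 e f) : S.card ≤ 4 := by
  have hfib (m : ℕ) (hm : ∀ x ∈ S, (if (edgeLevel (e.map (unplace x.1)),
      edgeLevel (f.map (unplace x.1))) ∈ sharedLevels then 2 else 4) ≤ m) :
      S.card ≤ m * (S.image Prod.fst).card := by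
    refine Finset.card_le_mul_card_image S m fun i hi ↦ ?_
    obtain ⟨x, hx, rfl⟩ := Finset.mem_image.1 hi
    obtain ⟨h1, h2⟩ := hS x hx
    have hcard : (S.filter fun y ↦ y.1 = x.1).card =
        ((S.filter fun y ↦ y.1 = x.1).image Prod.snd).card := by
      refine (Finset.card_image_of_injOn fun y hy z hz hyz ↦ ?_).symm
      exact Prod.ext ((Finset.mem_filter.1 hy).2.trans (Finset.mem_filter.1 hz).2.symm) hyz
    rw [hcard]
    refine le_trans (h2.card_le (mem_hitIndices.1 h1).2 _ fun k' hk' ↦ ?_) (hm x hx)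
    obtain ⟨y, hy, rfl⟩ := Finset.mem_image.1 hk'
    obtain ⟨hy, hyx⟩ := Finset.mem_filter.1 hy
    rw [← hyx]
    exact ⟨(mem_hitIndices.1 (hS y hy).1).2, (hS y hy).2⟩
  have hlev (x : ℕ × ℕ) (hx : x ∈ S) :=
    (nonadjacentPairs_bound _ x.2 (mem_hitIndices.1 (hS x hx).1).2 _ (hS x hx).2.1).1
  by_cases hsame : ∀ x ∈ S, ∀ y ∈ S, x.1 = y.1
  · have himg : (S.image Prod.fst).card ≤ 1 := by
      refine Finset.card_le_one.2 fun i hi j hj ↦ ?_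
      obtain ⟨x, hx, rfl⟩ := Finset.mem_image.1 hi
      obtain ⟨y, hy, rfl⟩ := Finset.mem_image.1 hj
      exact hsame x hx y hy
    refine (hfib 4 fun y hy ↦ ?_).trans (by omega)
    split_ifs <;> omega
  · push Not at hsame
    obtain ⟨x, hx, y, hy, hxy⟩ := hsame
    obtain ⟨hx1, hx2⟩ := (hS x hx).2.2
    obtain ⟨hy1, hy2⟩ := (hS y hy).2.2
    obtain ⟨hxs, hys, hr⟩ := pairLevels_parallel _ (hlev x hx) _ (hlev y hy)
      ⟨by simp only; omega, by simp only; omega⟩ fun h ↦ hxy (by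
        have := congrArg Prod.fst h
        simp only at this
        omega)
    have hr (z : ℕ × ℕ) (hz : z ∈ S) := hr _ (hlev z hz) (by
      obtain ⟨hz1, hz2⟩ := (hS z hz).2.2
      exact ⟨by simp only; omega, by simp only; omega⟩)
    have himg : (S.image Prod.fst).card ≤ 2 := by
      refine (Finset.card_le_card (t := {x.1, y.1}) ?_).trans Finset.card_le_two
      intro j hj
      obtain ⟨z, hz, rfl⟩ := Finset.mem_image.1 hj
      obtain ⟨hz1, hz2⟩ := (hS z hz).2.2
      rw [Finset.mem_insert, Finset.mem_singleton]
      rcases hr z hz with h | h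
      · have := congrArg Prod.fst h
        simp only at this
        omega
      · have := congrArg Prod.fst h
        simp only at this
        omega
    refine (hfib 2 fun z hz ↦ ?_).trans (by omega)
    rw [if_pos]
    rcases hr z hz with h | h <;> rw [h] <;> assumption

theorem le_ncard_crossings {n : ℕ} (hn : 1 ≤ n) (D : Drawing (G6_110 □ pathGraph (n + 1)))
    (hD : D.crossings.Finite) : 3 * n - 1 ≤ D.crossings.ncard := by
  classical
  have hex (x : ℕ × ℕ) : ∃ y, x ∈ hitIndices n → y ∈ D.crossings ∧
      ∃ e f, y.1 = s(e, f) ∧ IsHit n x.1 x.2 e.1 f.1 := by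
    by_cases hx : x ∈ hitIndices n
    · obtain ⟨y, hy, h⟩ := exists_isHit hn (mem_hitIndices.1 hx).1 x.2 D
      exact ⟨y, fun _ ↦ ⟨hy, h⟩⟩
    · obtain ⟨y, -⟩ := exists_isHit hn (Nat.zero_le n) 0 D
      exact ⟨y, fun h ↦ (hx h).elim⟩
  choose φ hφ using hex
  have key : (hitIndices n).card ≤ 4 * hD.toFinset.card := by
    refine Finset.card_le_mul_card_image_of_maps_to (f := φ)
      (fun x hx ↦ hD.mem_toFinset.2 (hφ x hx).1) 4 fun y hy ↦ ?_
    obtain ⟨e, f, -, hef, -⟩ := hD.mem_toFinset.1 hy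
    refine card_isHit_le e.1 f.1 _ fun x hx ↦ ?_
    obtain ⟨hx', rfl⟩ := Finset.mem_filter.1 hx
    obtain ⟨-, e', f', h, hit⟩ := hφ x hx'
    refine ⟨hx', ?_⟩
    rcases Sym2.eq_iff.1 (hef.symm.trans h) with ⟨rfl, rfl⟩ | ⟨rfl, rfl⟩
    · exact hit
    · exact hit.symm
  rw [card_hitIndices hn, ← Set.ncard_eq_toFinset_card _ hD] at key
  omega

/-- The crossing number of `G⁶₁₁₀ □ Pₙ` is `3n - 1` for all `n ≥ 1`. -/
theorem crossingNumber_G6_110_boxProd_path (n : ℕ) (hn : 1 ≤ n) :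
    crossingNumber (G6_110 □ SimpleGraph.pathGraph (n + 1)) = 3 * n - 1 := by
  obtain ⟨D, hD, hle⟩ := exists_drawing_ncard_crossings_le hn
  have hmem : D.crossings.ncard ∈ {m : ℕ | ∃ D : Drawing (G6_110 □ SimpleGraph.pathGraph (n + 1)),
      D.crossings.Finite ∧ D.crossings.ncard = m} := ⟨D, hD, rfl⟩
  refine le_antisymm ((Nat.sInf_le hmem).trans hle) ?_
  obtain ⟨D', hD', h⟩ := Nat.sInf_mem ⟨_, hmem⟩
  exact (le_ncard_crossings hn D' hD').trans h.le
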